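/- The temporal graph G_SC constructed from a Set Cover instance is bidirectionally temporally connected. -/

import Mathlib

namespace TemporalPaper

/-- A temporal graph on vertex set `V`: an undirected labeling assigning to each
(unordered) pair of vertices a finite set of rational time labels; a pair is an
edge of the graph iff its label set is nonempty. -/
structure TemporalGraph (V : Type*) where
  label : V → V → Finset ℚ
  symm : ∀ u v, label u v = label v u
  loopless : ∀ v, label v v = ∅

namespace TemporalGraph

variable {V : Type*}

/-- The footprint (static underlying graph) of a temporal graph. -/
def footprint (G : TemporalGraph V) : SimpleGraph V where
  Adj u v := (G.label u v).Nonempty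
  symm := ⟨fun u v h => by rwa [G.symm]⟩
  loopless := ⟨fun v h => by rw [G.loopless] at h; exact Finset.not_nonempty_empty h⟩

/-- The snapshot of a temporal graph at time `t`. -/
def snapshot (G : TemporalGraph V) (t : ℚ) : SimpleGraph V where
  Adj u v := t ∈ G.label u v
  symm := ⟨fun u v h => by rwa [G.symm]⟩
  loopless := ⟨fun v h => by rw [G.loopless] at h; exact absurd h (Finset.notMem_empty t)⟩

/-- `G.IsTJ r p ts` : the list of vertices `p` together with the list of times `ts`
(one per consecutive pair of vertices of `p`) forms a temporal walk, i.e. each time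
belongs to the labels of the corresponding edge, and consecutive times satisfy `r`
(`r = (· ≤ ·)` for non-strict temporal walks, `r = (· < ·)` for strict ones). -/
inductive IsTJ (G : TemporalGraph V) (r : ℚ → ℚ → Prop) : List V → List ℚ → Prop
  | single (v : V) : IsTJ G r [v] []
  | cons {u v : V} {p : List V} {t : ℚ} {ts : List ℚ} :
      t ∈ G.label u v → IsTJ G r (v :: p) ts →
      (∀ t' ∈ ts.head?, r t t') → IsTJ G r (u :: v :: p) (t :: ts)

/-- A temporal path from `u` to `v` with underlying (vertex-)path `p` and times `ts`. -/
def TPath (G : TemporalGraph V) (r : ℚ → ℚ → Prop) (u v : V)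
    (p : List V) (ts : List ℚ) : Prop :=
  G.IsTJ r p ts ∧ p.Nodup ∧ p.head? = some u ∧ p.getLast? = some v

/-- Temporal reachability. -/
def Reach (G : TemporalGraph V) (r : ℚ → ℚ → Prop) (u v : V) : Prop :=
  ∃ p ts, G.TPath r u v p ts

def TemporallyConnectedRel (G : TemporalGraph V) (r : ℚ → ℚ → Prop) : Prop :=
  ∀ u v : V, u ≠ v → G.Reach r u v

/-- Temporal connectivity (non-strict setting). -/
def TemporallyConnected (G : TemporalGraph V) : Prop :=
  G.TemporallyConnectedRel (· ≤ ·)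

/-- A bidirectional temporal path (bi-path) between `u` and `v` on the underlying
path `p` (from `u` to `v`): a temporal path in each direction along `p`. -/
def BiPath (G : TemporalGraph V) (r : ℚ → ℚ → Prop) (u v : V)
    (p : List V) (ts₁ ts₂ : List ℚ) : Prop :=
  G.TPath r u v p ts₁ ∧ G.TPath r v u p.reverse ts₂

def BiConnectedRel (G : TemporalGraph V) (r : ℚ → ℚ → Prop) : Prop :=
  ∀ u v : V, u ≠ v → ∃ p ts₁ ts₂, G.BiPath r u v p ts₁ ts₂

/-- Bidirectional temporal connectivity (non-strict setting). -/
def BiConnected (G : TemporalGraph V) : Prop := G.BiConnectedRel (· ≤ ·)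

/-- `H` is a temporal subgraph of `G` (on the same vertex set). -/
def IsSubgraph (H G : TemporalGraph V) : Prop := ∀ u v, H.label u v ⊆ G.label u v

/-- A temporal spanner of `G`: a temporally connected temporal subgraph on all of `V`. -/
def IsSpanner (H G : TemporalGraph V) : Prop := H.IsSubgraph G ∧ H.TemporallyConnected

/-- A temporal spanning tree of `G`: a temporal spanner whose footprint is a tree. -/
def IsSpanningTree (H G : TemporalGraph V) : Prop := H.IsSpanner G ∧ H.footprint.IsTree

/-- A bidirectional temporal spanner (bi-spanner) of `G`. -/
def IsBiSpanner (H G : TemporalGraph V) : Prop := H.IsSpanner G ∧ H.BiConnected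

/-- A temporal graph is simple if every edge has exactly one time label,
i.e. every label set has at most one element (edges have nonempty label sets). -/
def Simple (G : TemporalGraph V) : Prop := ∀ u v, (G.label u v).card ≤ 1

/-- A temporal graph is proper if any two (distinct) edges sharing a vertex have
disjoint label sets. -/
def Proper (G : TemporalGraph V) : Prop :=
  ∀ u v w : V, v ≠ w → Disjoint (G.label u v) (G.label u w)

def Happy (G : TemporalGraph V) : Prop := G.Simple ∧ G.Proper

/-- `u` can reach `v` by a (non-strict) temporal path arriving at time at most `t`. -/
def ArrivesBy (G : TemporalGraph V) (u v : V) (t : ℚ) : Prop :=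
  ∃ p ts, G.TPath (· ≤ ·) u v p ts ∧ ∀ t' ∈ ts.getLast?, t' ≤ t

/-- `u` can reach `v` by a (non-strict) temporal path departing at time at least `t`. -/
def DepartsAfter (G : TemporalGraph V) (u v : V) (t : ℚ) : Prop :=
  ∃ p ts, G.TPath (· ≤ ·) u v p ts ∧ ∀ t' ∈ ts.head?, t ≤ t'

/-- A pivot: some time `t` such that every other vertex reaches `x` by time `t`
and `x` reaches every other vertex departing not earlier than `t`. -/
def IsPivot (G : TemporalGraph V) (x : V) : Prop :=
  ∃ t : ℚ, ∀ u : V, u ≠ x → G.ArrivesBy u x t ∧ G.DepartsAfter x u t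

/-- Deleting the (undirected) edge `ab` from a temporal graph. -/
def deleteEdge [DecidableEq V] (G : TemporalGraph V) (a b : V) : TemporalGraph V where
  label u v := if (u = a ∧ v = b) ∨ (u = b ∧ v = a) then ∅ else G.label u v
  symm := by
    intro u v
    have h : ((u = a ∧ v = b) ∨ (u = b ∧ v = a)) ↔ ((v = a ∧ u = b) ∨ (v = b ∧ u = a)) := by
      tauto
    rw [G.symm, if_congr h rfl rfl]
  loopless := by
    intro v
    split_ifs with h
    · rfl
    · exact G.loopless v

end TemporalGraph

end TemporalPaper

namespace TemporalPaper

open TemporalGraph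

/-- Vertices of the temporal graph `G_SC` built from a Set Cover instance with
universe `U = {u_1, …, u_n}` and subsets `S_1, …, S_m`: one vertex per element of `U`,
one vertex per subset, and three auxiliary vertices `v`, `v₁`, `v₂`. -/
inductive Vsc (n m : ℕ) : Type
  | elem : Fin n → Vsc n m
  | set : Fin m → Vsc n m
  | v : Vsc n m
  | v1 : Vsc n m
  | v2 : Vsc n m
deriving DecidableEq

/-- One orientation of the labeling of `G_SC` (indices taken `1`-based as in the
paper): `v s_i` and, for `u_j ∈ S_i`, `s_i u_j` carry label `i`; `v₁ s_i` and
`v₁ u_j` carry label `m+1`; `v₂ v` and `v₂ s_i` carry label `m+2`; finally the edges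
`v₁ v`, `v₁ v₂` and `v₂ u_j` carry pairwise distinct labels (`m+3`, `m+4` and
`m+5+j`) distinct from all other labels of the graph. -/
def coreSC (n m : ℕ) (S : Fin m → Finset (Fin n)) : Vsc n m → Vsc n m → Finset ℚ
  | .v, .set i => {(i : ℚ) + 1}
  | .set i, .elem j => if j ∈ S i then {(i : ℚ) + 1} else ∅
  | .v1, .set _ => {(m : ℚ) + 1}
  | .v1, .elem _ => {(m : ℚ) + 1}
  | .v2, .v => {(m : ℚ) + 2}
  | .v2, .set _ => {(m : ℚ) + 2}
  | .v1, .v => {(m : ℚ) + 3}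
  | .v1, .v2 => {(m : ℚ) + 4}
  | .v2, .elem j => {(m : ℚ) + 5 + (j : ℚ)}
  | _, _ => ∅

/-- The simple temporal graph `G_SC` of the reduction from Set Cover to `k`-BS. -/
def Gsc (n m : ℕ) (S : Fin m → Finset (Fin n)) : TemporalGraph (Vsc n m) where
  label a b := coreSC n m S a b ∪ coreSC n m S b a
  symm := fun a b => Finset.union_comm _ _
  loopless := fun a => by cases a <;> simp [coreSC]

end TemporalPaper

namespace TemporalPaper

namespace TemporalGraph

variable {V : Type*} {G : TemporalGraph V} {r : ℚ → ℚ → Prop}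

/-- A single contact joins its endpoints by a bi-path. -/
theorem exists_biPath_of_mem_label {u v : V} {t : ℚ} (huv : u ≠ v) (h : t ∈ G.label u v) :
    ∃ p ts₁ ts₂, G.BiPath r u v p ts₁ ts₂ := by
  have h' : t ∈ G.label v u := G.symm u v ▸ h
  exact ⟨[u, v], [t], [t],
    ⟨.cons h (.single v) (by simp), by simp [huv], rfl, rfl⟩,
    ⟨.cons h' (.single u) (by simp), by simp [huv.symm], rfl, rfl⟩⟩

/-- Two consecutive contacts at a common time form a bi-path when waiting zero time is allowed. -/
theorem exists_biPath_of_mem_label_of_mem_label [Std.Refl r] {u w v : V} {t : ℚ} (huv : u ≠ v)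
    (h₁ : t ∈ G.label u w) (h₂ : t ∈ G.label w v) :
    ∃ p ts₁ ts₂, G.BiPath r u v p ts₁ ts₂ := by
  have huw : u ≠ w := by
    rintro rfl
    simp [G.loopless] at h₁
  have hwv : w ≠ v := by
    rintro rfl
    simp [G.loopless] at h₂
  have h₁' : t ∈ G.label w u := G.symm u w ▸ h₁
  have h₂' : t ∈ G.label v w := G.symm w v ▸ h₂
  have hr : ∀ t' ∈ [t].head?, r t t' := by simpa using Std.Refl.refl (r := r) t
  exact ⟨[u, w, v], [t, t], [t, t],
    ⟨.cons h₁ (.cons h₂ (.single v) (by simp)) hr, by simp [huv, huw, hwv], rfl, rfl⟩,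
    ⟨.cons h₂' (.cons h₁' (.single u) (by simp)) hr,
      by simp [huv.symm, huw.symm, hwv.symm], rfl, rfl⟩⟩

end TemporalGraph

/-- Claim 4: if the union of the `S_i` equals the universe, then the
temporal graph `G_SC` is bidirectionally temporally connected. -/
theorem stmt16 (n m : ℕ) (S : Fin m → Finset (Fin n))
    (hcover : ∀ j : Fin n, ∃ i : Fin m, j ∈ S i) :
    (Gsc n m S).BiConnected := by
  intro a b hab
  rcases a with j | i | _ | _ | _ <;> rcases b with j' | i' | _ | _ | _
  case elem.elem | elem.set | set.elem | set.set =>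
    exact TemporalGraph.exists_biPath_of_mem_label_of_mem_label (w := .v1) (t := m + 1) hab
      (by simp [Gsc, coreSC]) (by simp [Gsc, coreSC])
  case elem.v =>
    obtain ⟨i, hi⟩ := hcover j
    exact TemporalGraph.exists_biPath_of_mem_label_of_mem_label (w := .set i) (t := i + 1) hab
      (by simp [Gsc, coreSC, hi]) (by simp [Gsc, coreSC])
  case v.elem =>
    obtain ⟨i, hi⟩ := hcover j'
    exact TemporalGraph.exists_biPath_of_mem_label_of_mem_label (w := .set i) (t := i + 1) hab
      (by simp [Gsc, coreSC]) (by simp [Gsc, coreSC, hi])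
  case v.v | v1.v1 | v2.v2 => exact absurd rfl hab
  all_goals
    refine TemporalGraph.exists_biPath_of_mem_label hab (t := ?_) ?_
    rotate_left
    · simp only [Gsc, coreSC, Finset.empty_union, Finset.union_empty]
      exact Finset.mem_singleton_self _

end TemporalPaper
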